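/- For all constants A, B, α, β > 0 there exist constants A', B' > 0, depending only on A, B, α, β, with the following property: for every n ≥ 1 and every symmetric convex body K ⊂ ℝⁿ, if the cone measure satisfies 𝒞_K{x : | |x| - 1 | ≥ u} ≤ A·exp(-B·n^α·u^β) for all u ∈ [0,1], then the volume measure satisfies 𝒱_K{x : | |x| - 1 | ≥ u} ≤ A'·exp(-B'·n^{min(α,1)}·u^{max(β,1)}) for all u ∈ [0,1]. -/

import Mathlib

open MeasureTheory Real

/-- The normalised volume measure of a convex body `K`:
`𝒱_K(A) = vol(A ∩ K)/vol(K)`. -/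
noncomputable def volMeasure {n : ℕ} (K A : Set (EuclideanSpace ℝ (Fin n))) : ℝ :=
  (volume (A ∩ K) / volume K).toReal

/-- The cone measure of a convex body `K`:
`𝒞_K(A) = vol{x ∈ K : x/‖x‖_K ∈ A}/vol(K)`, where `‖·‖_K` is the Minkowski gauge of `K`. -/
noncomputable def coneMeasure {n : ℕ} (K A : Set (EuclideanSpace ℝ (Fin n))) : ℝ :=
  (volume {x ∈ K | (gauge K x)⁻¹ • x ∈ A} / volume K).toReal

section Gauge

open scoped Pointwise

theorem zero_mem_interior_of_eq_neg {E : Type*} [NormedAddCommGroup E] [NormedSpace ℝ E]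
    {K : Set E} (hK : Convex ℝ K) (hne : (interior K).Nonempty) (hsymm : K = -K) :
    (0 : E) ∈ interior K := by
  obtain ⟨x, hx⟩ := hne
  have hnx : -x ∈ interior K := by
    have h : -interior K ⊆ interior K := by
      refine interior_maximal ?_ isOpen_interior.neg
      intro y hy
      rw [hsymm]
      exact Set.mem_neg.2 (interior_subset (Set.mem_neg.1 hy))
    exact h (by simpa using hx)
  have h := hK.interior hx hnx (a := 1 / 2) (b := 1 / 2) (by norm_num) (by norm_num) (by norm_num)
  simpa using h

theorem gauge_sublevel_subset_smul {E : Type*} [NormedAddCommGroup E] [NormedSpace ℝ E]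
    {K : Set E} (hK : Convex ℝ K) (hcl : IsClosed K) (h0 : K ∈ nhds 0) {t : ℝ} (ht : 0 < t) :
    {x | gauge K x ≤ t} ⊆ t • K := by
  intro x hx
  rw [Set.mem_smul_set_iff_inv_smul_mem₀ ht.ne']
  rw [← hcl.closure_eq, ← gauge_le_one_iff_mem_closure hK h0,
    gauge_smul_of_nonneg (inv_nonneg.2 ht.le), smul_eq_mul, inv_mul_le_iff₀ ht, mul_one]
  exact hx

theorem half_le_abs_norm_inv_smul_sub_one {E : Type*} [NormedAddCommGroup E] [NormedSpace ℝ E]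
    {x : E} {g u : ℝ} (hu0 : 0 ≤ u) (hu1 : u ≤ 1) (hg : 1 - u / 2 < g) (hg1 : g ≤ 1)
    (hx : u ≤ |‖x‖ - 1|) : u / 2 ≤ |‖g⁻¹ • x‖ - 1| := by
  have hgpos : 0 < g := by linarith
  rw [norm_smul, norm_inv, Real.norm_of_nonneg hgpos.le, inv_mul_eq_div]
  rcases le_abs.1 hx with h | h
  · have h1 : ‖x‖ ≤ ‖x‖ / g := le_div_self (norm_nonneg x) hgpos hg1
    exact le_abs.2 (Or.inl (by linarith))
  · have h1 : ‖x‖ / g ≤ 1 - u / 2 := by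
      rw [div_le_iff₀ hgpos]
      nlinarith [sq_nonneg u]
    exact le_abs.2 (Or.inr (by linarith))

theorem volMeasure_le_coneMeasure_add_pow {n : ℕ} {K : Set (EuclideanSpace ℝ (Fin n))}
    (hcpt : IsCompact K) (hK : Convex ℝ K) (hne : (interior K).Nonempty) (hsymm : K = -K)
    {u : ℝ} (hu0 : 0 ≤ u) (hu1 : u ≤ 1) :
    volMeasure K {x | u ≤ |‖x‖ - 1|} ≤
      coneMeasure K {x | u / 2 ≤ |‖x‖ - 1|} + (1 - u / 2) ^ n := by
  have h0 : K ∈ nhds 0 := mem_interior_iff_mem_nhds.1 (zero_mem_interior_of_eq_neg hK hne hsymm)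
  have ht : 0 < 1 - u / 2 := by linarith
  have hfin : volume K ≠ ⊤ := hcpt.measure_lt_top.ne
  have hpos : volume K ≠ 0 := (Measure.measure_pos_of_nonempty_interior volume hne).ne'
  have hsub : {x | u ≤ |‖x‖ - 1|} ∩ K ⊆
      {x ∈ K | (gauge K x)⁻¹ • x ∈ {x | u / 2 ≤ |‖x‖ - 1|}} ∪ (1 - u / 2) • K := by
    rintro x ⟨hx, hxK⟩
    rcases le_or_gt (gauge K x) (1 - u / 2) with h | h
    · exact Or.inr (gauge_sublevel_subset_smul hK hcpt.isClosed h0 ht h)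
    · exact Or.inl
        ⟨hxK, half_le_abs_norm_inv_smul_sub_one hu0 hu1 h (gauge_le_one_of_mem hxK) hx⟩
  have hvol := (measure_mono hsub).trans (measure_union_le (μ := volume) _ _)
  rw [Measure.addHaar_smul, finrank_euclideanSpace_fin, abs_of_pos (pow_pos ht n)] at hvol
  have hC : volume {x ∈ K | (gauge K x)⁻¹ • x ∈ {x | u / 2 ≤ |‖x‖ - 1|}} / volume K ≠ ⊤ :=
    ENNReal.div_ne_top (measure_ne_top_of_subset (Set.sep_subset _ _) hfin) hpos
  have hdiv := ENNReal.div_le_div_right hvol (volume K)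
  rw [ENNReal.add_div, mul_div_assoc, ENNReal.div_self hpos hfin, mul_one] at hdiv
  have h := ENNReal.toReal_mono (ENNReal.add_ne_top.2 ⟨hC, ENNReal.ofReal_ne_top⟩) hdiv
  rwa [ENNReal.toReal_add hC ENNReal.ofReal_ne_top,
    ENNReal.toReal_ofReal (pow_pos ht n).le] at h

theorem one_sub_pow_le_exp_neg_mul {n : ℕ} {t : ℝ} (ht : t ≤ 1) :
    (1 - t) ^ n ≤ Real.exp (-(n * t)) := by
  rw [← mul_neg, Real.exp_nat_mul]
  exact pow_le_pow_left₀ (by linarith) (Real.one_sub_le_exp_neg t) n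

end Gauge

theorem stmt17 (A B α β : ℝ) (hA : 0 < A) (hB : 0 < B) (hα : 0 < α) (hβ : 0 < β) :
    ∃ A' B' : ℝ, 0 < A' ∧ 0 < B' ∧
      ∀ (n : ℕ), 1 ≤ n →
        ∀ K : Set (EuclideanSpace ℝ (Fin n)),
          IsCompact K → Convex ℝ K → (interior K).Nonempty → K = -K →
          (∀ u ∈ Set.Icc (0:ℝ) 1,
            coneMeasure K {x | u ≤ |‖x‖ - 1|} ≤ A * Real.exp (-B * (n : ℝ) ^ α * u ^ β)) →
          ∀ u ∈ Set.Icc (0:ℝ) 1,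
            volMeasure K {x | u ≤ |‖x‖ - 1|} ≤
              A' * Real.exp (-B' * (n : ℝ) ^ min α 1 * u ^ max β 1) := by
  refine ⟨A + 1, min (B * (1 / 2) ^ β) (1 / 2), by positivity, by positivity, ?_⟩
  rintro n hn K hcpt hK hne hsymm hcone u ⟨hu0, hu1⟩
  have hn' : (1 : ℝ) ≤ n := by exact_mod_cast hn
  have hexp : ∀ {γ δ : ℝ}, min α 1 ≤ γ → 0 < δ → δ ≤ max β 1 →
      (n : ℝ) ^ min α 1 * u ^ max β 1 ≤ (n : ℝ) ^ γ * u ^ δ := by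
    intro γ δ hγ hδ hδ'
    have hu : u ^ max β 1 ≤ u ^ δ := by
      rcases hu0.eq_or_lt with rfl | hu
      · rw [Real.zero_rpow hδ.ne', Real.zero_rpow (hδ.trans_le hδ').ne']
      · exact Real.rpow_le_rpow_of_exponent_ge hu hu1 hδ'
    gcongr
  have hP : 0 ≤ (n : ℝ) ^ min α 1 * u ^ max β 1 := by positivity
  have h₁ := hexp (min_le_left α 1) hβ (le_max_left β 1)
  have h₂ := hexp (min_le_right α 1) one_pos (le_max_right β 1)
  rw [Real.rpow_one, Real.rpow_one] at h₂
  have hcone' : coneMeasure K {x | u / 2 ≤ |‖x‖ - 1|} ≤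
      A * Real.exp (-min (B * (1 / 2) ^ β) (1 / 2) * (n : ℝ) ^ min α 1 * u ^ max β 1) := by
    refine (hcone (u / 2) ⟨by linarith, by linarith⟩).trans ?_
    gcongr A * Real.exp ?_
    rw [div_eq_mul_one_div u 2, Real.mul_rpow hu0 (by norm_num)]
    have h := mul_le_mul (min_le_left (B * (1 / 2) ^ β) (1 / 2)) h₁ hP (by positivity)
    linarith
  have hpow : (1 - u / 2) ^ n ≤
      Real.exp (-min (B * (1 / 2) ^ β) (1 / 2) * (n : ℝ) ^ min α 1 * u ^ max β 1) := by
    refine (one_sub_pow_le_exp_neg_mul (by linarith)).trans (Real.exp_le_exp.2 ?_)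
    have h := mul_le_mul (min_le_right (B * (1 / 2) ^ β) (1 / 2)) h₂ hP (by norm_num)
    linarith
  linarith [volMeasure_le_coneMeasure_add_pow hcpt hK hne hsymm hu0 hu1]
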